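/- arXiv:2205.00539 — 6 statements merged into one kernel-verified Lean document; each statement's English description precedes it below -/
import Mathlib

section
/- Successor rule for the binary reflected Gray code: for every n ≥ 1 and every r with 0 ≤ r ≤ 2^n − 2, writing G^n_r = a_{n−1}⋯a_0: (i) if r is even, then G^n_{r+1} is obtained from G^n_r by flipping bit 0; (ii) if r is odd, then G^n_r contains at least one 1, the minimal position i with a_i = 1 satisfies i + 1 ≤ n − 1, and G^n_{r+1} is obtained from G^n_r by flipping bit i + 1. -/
/-- The binary reflected Gray code `G^n` as a list of words over `{0,1}`,
with the head of each list being the most significant bit `a_{n-1}`. -/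
def grayCode : ℕ → List (List Bool)
  | 0 => [[]]
  | n + 1 => (grayCode n).map (List.cons false) ++ ((grayCode n).reverse.map (List.cons true))

/-- The word `G^n_r` (the `r`-th word of the binary reflected Gray code of length `n`). -/
def grayWord (n r : ℕ) : List Bool := (grayCode n).getD r []

/-- Bit `a_j` of a word `w = a_{n-1}⋯a_1a_0` (head of the list is `a_{n-1}`). -/
def wordBit (w : List Bool) (j : ℕ) : Bool := w.getD (w.length - 1 - j) false

/-- Flipping bit `a_j` of a word `w = a_{n-1}⋯a_1a_0`. -/
def flipBit (w : List Bool) (j : ℕ) : List Bool :=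
  w.set (w.length - 1 - j) (!wordBit w j)

theorem length_grayCode (n : ℕ) : (grayCode n).length = 2 ^ n := by
  induction n with
  | zero => rfl
  | succ n ih => simp [grayCode, ih, pow_succ, mul_two]

theorem grayWord_succ_of_lt {n r : ℕ} (h : r < 2 ^ n) :
    grayWord (n + 1) r = false :: grayWord n r := by
  have hl : r < (grayCode n).length := by rwa [length_grayCode]
  simp [grayWord, grayCode, List.getD_eq_getElem?_getD, List.getElem?_append, hl]

theorem grayWord_succ_of_add_eq {n r s : ℕ} (hs : s < 2 ^ n) (h : r + s + 1 = 2 ^ (n + 1)) :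
    grayWord (n + 1) r = true :: grayWord n s := by
  rw [pow_succ] at h
  have hlen := length_grayCode n
  have hl : s < (grayCode n).length := by rwa [hlen]
  have hr : ¬ r < (grayCode n).length := by omega
  have hr' : r - (grayCode n).length < (grayCode n).length := by omega
  have he : (grayCode n).length - 1 - (r - (grayCode n).length) = s := by omega
  simp [grayWord, grayCode, List.getD_eq_getElem?_getD, List.getElem?_append, -List.map_reverse, hr,
    List.getElem?_reverse hr', he, hl]

theorem length_grayWord {n r : ℕ} (h : r < 2 ^ n) : (grayWord n r).length = n := by
  induction n generalizing r with
  | zero =>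
    obtain rfl : r = 0 := by simpa using h
    rfl
  | succ n ih =>
    have hp := pow_succ 2 n
    by_cases hr : r < 2 ^ n
    · simp [grayWord_succ_of_lt hr, ih hr]
    · have hs : 2 ^ (n + 1) - 1 - r < 2 ^ n := by omega
      rw [grayWord_succ_of_add_eq hs (by omega), List.length_cons, ih hs]

theorem wordBit_cons_of_lt (b : Bool) {w : List Bool} {j : ℕ} (h : j < w.length) :
    wordBit (b :: w) j = wordBit w j := by
  have he : (b :: w).length - 1 - j = w.length - 1 - j + 1 := by
    simp only [List.length_cons]; omega
  simp only [wordBit, he, List.getD_cons_succ]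

theorem wordBit_cons_of_length_eq (b : Bool) {w : List Bool} {n : ℕ} (h : w.length = n) :
    wordBit (b :: w) n = b := by
  simp [wordBit, h]

theorem flipBit_cons_of_lt (b : Bool) {w : List Bool} {j : ℕ} (h : j < w.length) :
    flipBit (b :: w) j = b :: flipBit w j := by
  have he : (b :: w).length - 1 - j = w.length - 1 - j + 1 := by
    simp only [List.length_cons]; omega
  simp only [flipBit, wordBit_cons_of_lt b h, he, List.set_cons_succ]

theorem flipBit_cons_of_length_eq (b : Bool) {w : List Bool} {n : ℕ} (h : w.length = n) :
    flipBit (b :: w) n = (!b) :: w := by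
  simp [flipBit, wordBit_cons_of_length_eq b h, h]

theorem length_flipBit (w : List Bool) (j : ℕ) : (flipBit w j).length = w.length := by
  simp [flipBit]

theorem wordBit_flipBit_self {w : List Bool} {j : ℕ} (h : j < w.length) :
    wordBit (flipBit w j) j = !wordBit w j := by
  have hj : w.length - 1 - j < w.length := by omega
  rw [wordBit, length_flipBit, flipBit]
  simp [List.getD_eq_getElem?_getD, hj]

theorem wordBit_flipBit_of_ne {w : List Bool} {i j : ℕ} (hi : i < w.length)
    (hj : j < w.length) (h : i ≠ j) : wordBit (flipBit w j) i = wordBit w i := by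
  have hne : w.length - 1 - j ≠ w.length - 1 - i := by omega
  rw [wordBit, length_flipBit, flipBit]
  simp [wordBit, List.getD_eq_getElem?_getD, List.getElem?_set_ne hne]

theorem flipBit_flipBit {w : List Bool} {j : ℕ} (h : j < w.length) :
    flipBit (flipBit w j) j = w := by
  have hj : w.length - 1 - j < w.length := by omega
  rw [flipBit, length_flipBit, wordBit_flipBit_self h, flipBit]
  simp [wordBit, List.getD_eq_getElem?_getD, hj]

theorem wordBit_grayWord_zero {n i : ℕ} (h : i < n) : wordBit (grayWord n 0) i = false := by
  induction n with
  | zero => omega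
  | succ n ih =>
    have hlen : (grayWord n 0).length = n := length_grayWord (by positivity)
    rw [grayWord_succ_of_lt (by positivity)]
    rcases Nat.lt_succ_iff_lt_or_eq.mp h with hi | rfl
    · rw [wordBit_cons_of_lt _ (by omega), ih hi]
    · exact wordBit_cons_of_length_eq _ hlen

/-- The first `1` of the word `w`, counted from bit `0`, is at position `i`. -/
def IsLowestOne (w : List Bool) (i : ℕ) : Prop :=
  wordBit w i = true ∧ ∀ i' < i, wordBit w i' = false

theorem IsLowestOne.cons {w : List Bool} {i : ℕ} (h : IsLowestOne w i) (hi : i < w.length)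
    (b : Bool) : IsLowestOne (b :: w) i := by
  refine ⟨by rw [wordBit_cons_of_lt b hi, h.1], fun i' hi' => ?_⟩
  rw [wordBit_cons_of_lt b (by omega), h.2 i' hi']

theorem IsLowestOne.flipBit_of_lt {w : List Bool} {i j : ℕ} (h : IsLowestOne w i) (hij : i < j)
    (hj : j < w.length) : IsLowestOne (flipBit w j) i := by
  refine ⟨by rw [wordBit_flipBit_of_ne (by omega) hj (by omega), h.1], fun i' hi' => ?_⟩
  rw [wordBit_flipBit_of_ne (by omega) hj (by omega), h.2 i' hi']

theorem isLowestOne_grayWord_last (n : ℕ) :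
    IsLowestOne (grayWord (n + 1) (2 ^ (n + 1) - 1)) n := by
  have hpos : 0 < 2 ^ n := by positivity
  have hlen : (grayWord n 0).length = n := length_grayWord hpos
  rw [grayWord_succ_of_add_eq (s := 0) hpos (by rw [pow_succ]; omega)]
  refine ⟨wordBit_cons_of_length_eq _ hlen, fun i hi => ?_⟩
  rw [wordBit_cons_of_lt _ (by omega), wordBit_grayWord_zero hi]

theorem grayWord_succ_eq_flipBit (n r : ℕ) (hr : r + 1 < 2 ^ (n + 1)) :
    (r % 2 = 0 → grayWord (n + 1) (r + 1) = flipBit (grayWord (n + 1) r) 0) ∧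
    (r % 2 = 1 → ∃ i, IsLowestOne (grayWord (n + 1) r) i ∧ i + 1 < n + 1 ∧
      grayWord (n + 1) (r + 1) = flipBit (grayWord (n + 1) r) (i + 1)) := by
  induction n generalizing r with
  | zero =>
    obtain rfl : r = 0 := by omega
    exact ⟨fun _ => by decide, fun h => by omega⟩
  | succ n ih =>
    have hp := pow_succ 2 (n + 1)
    have hp' := pow_succ 2 n
    rcases lt_trichotomy (r + 1) (2 ^ (n + 1)) with h | h | h
    · have hlen : (grayWord (n + 1) r).length = n + 1 := length_grayWord (by omega)
      rw [grayWord_succ_of_lt h, grayWord_succ_of_lt (show r < 2 ^ (n + 1) by omega)]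
      refine ⟨fun hev => ?_, fun hodd => ?_⟩
      · rw [flipBit_cons_of_lt _ (by omega), (ih r h).1 hev]
      · obtain ⟨i, hi, hin, he⟩ := (ih r h).2 hodd
        refine ⟨i, hi.cons (by omega) _, by omega, ?_⟩
        rw [flipBit_cons_of_lt _ (by omega), he]
    · have hlen : (grayWord (n + 1) r).length = n + 1 := length_grayWord (by omega)
      rw [grayWord_succ_of_add_eq (show r < 2 ^ (n + 1) by omega) (by omega),
        grayWord_succ_of_lt (show r < 2 ^ (n + 1) by omega)]
      refine ⟨fun hev => by omega, fun _ => ⟨n, ?_, by omega, ?_⟩⟩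
      · obtain rfl : r = 2 ^ (n + 1) - 1 := by omega
        exact (isLowestOne_grayWord_last n).cons (by omega) _
      · exact (flipBit_cons_of_length_eq false hlen).symm
    · obtain ⟨s, hs⟩ : ∃ s, r + (s + 1) + 1 = 2 ^ (n + 1 + 1) :=
        ⟨2 ^ (n + 1 + 1) - 2 - r, by omega⟩
      have hs' : s + 1 < 2 ^ (n + 1) := by omega
      have hlen : (grayWord (n + 1) s).length = n + 1 := length_grayWord (by omega)
      have hlen' : (grayWord (n + 1) (s + 1)).length = n + 1 := length_grayWord hs'
      rw [grayWord_succ_of_add_eq hs' hs,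
        grayWord_succ_of_add_eq (show s < 2 ^ (n + 1) by omega) (by omega)]
      refine ⟨fun hev => ?_, fun hodd => ?_⟩
      · rw [flipBit_cons_of_lt _ (by omega), (ih s hs').1 (by omega),
          flipBit_flipBit (by omega)]
      · obtain ⟨i, hi, hin, he⟩ := (ih s hs').2 (by omega)
        refine ⟨i, ?_, by omega, ?_⟩
        · rw [he]
          exact (hi.flipBit_of_lt (by omega) (by omega)).cons
            (by rw [length_flipBit]; omega) _
        · rw [flipBit_cons_of_lt _ (by omega), he, flipBit_flipBit (by omega)]


/-- Successor rule for the binary reflected Gray code. For `n ≥ 1` and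
`0 ≤ r ≤ 2^n - 2`: (i) if `r` is even then `G^n_{r+1}` is obtained from `G^n_r` by
flipping bit `0`; (ii) if `r` is odd then `G^n_r` contains a `1`, the minimal position
`i` with `a_i = 1` satisfies `i + 1 ≤ n - 1`, and `G^n_{r+1}` is obtained from `G^n_r`
by flipping bit `i + 1`. -/
theorem gray_code_successor_rule (n r : ℕ) (hn : 1 ≤ n) (hr : r ≤ 2 ^ n - 2) :
    (r % 2 = 0 → grayWord n (r + 1) = flipBit (grayWord n r) 0) ∧
    (r % 2 = 1 →
      ∃ i : ℕ, wordBit (grayWord n r) i = true ∧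
        (∀ i' < i, wordBit (grayWord n r) i' = false) ∧
        i + 1 ≤ n - 1 ∧
        grayWord n (r + 1) = flipBit (grayWord n r) (i + 1)) := by
  obtain ⟨n, rfl⟩ := Nat.exists_eq_add_of_le' hn
  have hpos : 0 < 2 ^ n := by positivity
  have hp := pow_succ 2 n
  obtain ⟨heven, hodd⟩ := grayWord_succ_eq_flipBit n r (by omega)
  refine ⟨heven, fun h => ?_⟩
  obtain ⟨i, hi, hin, he⟩ := hodd h
  exact ⟨i, hi.1, hi.2, by omega, he⟩
end

section
/- Double-step rule: let n ≥ 2 and define a partial map f on {0,1}^n as follows: given y, first flip bit 0, obtaining y'; if y' contains at least one 1 and the minimal position i with y'_i = 1 satisfies i + 1 ≤ n − 1, then f(y) is y' with bit i + 1 flipped (otherwise f(y) is undefined). Then: (i) for every k ≥ 0 with 2k + 2 ≤ 2^n − 1, f is defined at G^n_{2k} and f(G^n_{2k}) = G^n_{2k+2}; (ii) for every k ≥ 1 with 2k + 1 ≤ 2^n − 1, f is defined at G^n_{2k+1} and f(G^n_{2k+1}) = G^n_{2k−1}. -/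
theorem grayWord_succ_of_ge {n r : ℕ} (h : 2 ^ n ≤ r) (h' : r < 2 ^ (n + 1)) :
    grayWord (n + 1) r = true :: grayWord n (2 ^ (n + 1) - 1 - r) := by
  have hl := length_grayCode n
  rw [pow_succ] at h' ⊢
  have hlt : r - 2 ^ n < 2 ^ n := by omega
  have hidx : 2 ^ n - 1 - (r - 2 ^ n) = 2 ^ n * 2 - 1 - r := by omega
  have hlt' : 2 ^ n * 2 - 1 - r < 2 ^ n := by omega
  simp [grayWord, grayCode, List.getD_eq_getElem?_getD, List.getElem?_append, hl, h.not_gt,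
    hlt, hidx, hlt']

theorem wordBit_cons {w : List Bool} {j : ℕ} (b : Bool) (h : j < w.length) :
    wordBit (b :: w) j = wordBit w j := by
  have : w.length - j = w.length - 1 - j + 1 := by omega
  simp [wordBit, this]

theorem wordBit_cons_length (b : Bool) (w : List Bool) : wordBit (b :: w) w.length = b := by
  simp [wordBit]

theorem flipBit_cons {w : List Bool} {j : ℕ} (b : Bool) (h : j < w.length) :
    flipBit (b :: w) j = b :: flipBit w j := by
  have : w.length - j = w.length - 1 - j + 1 := by omega
  simp [flipBit, wordBit_cons b h, this]

theorem flipBit_cons_length (b : Bool) (w : List Bool) :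
    flipBit (b :: w) w.length = (!b) :: w := by
  simp [flipBit, wordBit_cons_length]

theorem grayWord_zero (n : ℕ) : grayWord n 0 = List.replicate n false := by
  induction n with
  | zero => rfl
  | succ n ih => rw [grayWord_succ_of_lt (by positivity), ih, List.replicate_succ]

theorem flipBit_grayWord_one {n : ℕ} (hn : 1 ≤ n) :
    flipBit (grayWord n 1) 0 = grayWord n 0 := by
  induction n, hn using Nat.le_induction with
  | base => rfl
  | succ n hn ih =>
    have h : 1 < 2 ^ n := Nat.one_lt_two_pow (by omega)
    rw [grayWord_succ_of_lt h, grayWord_succ_of_lt (by omega),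
      flipBit_cons _ (by rw [length_grayWord h]; omega), ih]

theorem grayWord_last (n : ℕ) :
    grayWord (n + 1) (2 ^ (n + 1) - 1) = true :: List.replicate n false := by
  have h : 0 < 2 ^ n := by positivity
  rw [grayWord_succ_of_ge (by rw [pow_succ]; omega) (by rw [pow_succ]; omega), Nat.sub_self,
    grayWord_zero]

theorem flipBit_grayWord_penultimate {n : ℕ} (hn : 1 ≤ n) :
    flipBit (grayWord n (2 ^ n - 2)) 0 = grayWord n (2 ^ n - 1) := by
  obtain ⟨n, rfl⟩ := Nat.exists_eq_add_of_le' hn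
  rcases Nat.eq_zero_or_pos n with rfl | hpos
  · rfl
  have h : 1 < 2 ^ n := Nat.one_lt_two_pow (by omega)
  have hs : 2 ^ (n + 1) - 1 - (2 ^ (n + 1) - 2) = 1 := by rw [pow_succ]; omega
  rw [grayWord_succ_of_ge (by rw [pow_succ]; omega) (by rw [pow_succ]; omega), hs,
    flipBit_cons _ (by rw [length_grayWord h]; omega), flipBit_grayWord_one hpos, grayWord_last,
    grayWord_zero]

/-- The partial map of the double-step rule is defined at `w` and sends it to `w'`. -/
def DoubleStep (w w' : List Bool) : Prop :=
  ∃ i : ℕ, wordBit (flipBit w 0) i = true ∧ (∀ i' < i, wordBit (flipBit w 0) i' = false) ∧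
    i + 1 < w.length ∧ flipBit (flipBit w 0) (i + 1) = w'

theorem DoubleStep.cons {w w' : List Bool} (b : Bool) (h : DoubleStep w w') :
    DoubleStep (b :: w) (b :: w') := by
  obtain ⟨i, hi, hmin, hlt, rfl⟩ := h
  have hlen := length_flipBit w 0
  refine ⟨i, ?_, fun i' hi' => ?_, by simp; omega, ?_⟩ <;> rw [flipBit_cons b (by omega)]
  · rwa [wordBit_cons b (by omega)]
  · rw [wordBit_cons b (by omega)]
    exact hmin i' hi'
  · rw [flipBit_cons b (by omega)]

theorem wordBit_replicate_false (m j : ℕ) : wordBit (List.replicate m false) j = false := by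
  simp [wordBit, List.getD_eq_getElem?_getD, List.getElem?_replicate]
  grind

theorem doubleStep_of_flipBit_eq {w : List Bool} {m : ℕ} (b : Bool)
    (h : flipBit w 0 = true :: List.replicate m false) :
    DoubleStep (b :: w) ((!b) :: flipBit w 0) := by
  have hlen : w.length = m + 1 := by simp [← length_flipBit w 0, h]
  have hm : (List.replicate m false).length = m := List.length_replicate
  have hm' : (true :: List.replicate m false).length = m + 1 := by simp
  refine ⟨m, ?_, fun i' hi' => ?_, by simp [hlen], ?_⟩ <;> rw [flipBit_cons b (by omega), h]
  · rw [wordBit_cons b (by omega)]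
    simpa only [hm] using wordBit_cons_length true (List.replicate m false)
  · rw [wordBit_cons b (by omega), wordBit_cons true (by omega), wordBit_replicate_false]
  · simpa only [hm'] using flipBit_cons_length b (true :: List.replicate m false)

theorem doubleStep_grayWord_penultimate {n : ℕ} (hn : 1 ≤ n) (b : Bool) :
    DoubleStep (b :: grayWord n (2 ^ n - 2)) ((!b) :: grayWord n (2 ^ n - 1)) := by
  rw [← flipBit_grayWord_penultimate hn]
  obtain ⟨m, rfl⟩ := Nat.exists_eq_add_of_le' hn
  exact doubleStep_of_flipBit_eq b (by rw [flipBit_grayWord_penultimate hn, grayWord_last])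

theorem doubleStep_grayWord (n : ℕ) :
    (∀ k, 2 * k + 2 < 2 ^ n → DoubleStep (grayWord n (2 * k)) (grayWord n (2 * k + 2))) ∧
    ∀ k, 2 * k + 3 < 2 ^ n → DoubleStep (grayWord n (2 * k + 3)) (grayWord n (2 * k + 1)) := by
  induction n with
  | zero => constructor <;> intro k hk <;> simp at hk
  | succ n ih =>
    obtain ⟨ihe, iho⟩ := ih
    have hp : 2 ^ (n + 1) = 2 * 2 ^ n := by ring
    rcases Nat.eq_zero_or_pos n with rfl | hpos
    · constructor <;> intro k hk <;> simp at hk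
    obtain ⟨c, hc⟩ : ∃ c, 2 ^ n = 2 * c := dvd_pow_self 2 hpos.ne'
    refine ⟨fun k hk => ?_, fun k hk => ?_⟩
    · rcases lt_trichotomy (2 * k + 2) (2 ^ n) with h | h | h
      · rw [grayWord_succ_of_lt h, grayWord_succ_of_lt (by omega)]
        exact (ihe k h).cons false
      · rw [grayWord_succ_of_lt (by omega), grayWord_succ_of_ge h.ge hk]
        convert doubleStep_grayWord_penultimate hpos false using 3 <;> first | rfl | omega
      · rw [grayWord_succ_of_ge (by omega) (by omega), grayWord_succ_of_ge h.le hk]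
        convert (iho (2 * c - k - 2) (by omega)).cons true using 3 <;> omega
    · rcases lt_trichotomy (2 * k + 2) (2 ^ n) with h | h | h
      · rw [grayWord_succ_of_lt (r := 2 * k + 3) (by omega), grayWord_succ_of_lt (by omega)]
        exact (iho k (by omega)).cons false
      · rw [grayWord_succ_of_ge (by omega) hk, grayWord_succ_of_lt (by omega)]
        convert doubleStep_grayWord_penultimate hpos true using 3 <;> first | rfl | omega
      · rw [grayWord_succ_of_ge (by omega) hk, grayWord_succ_of_ge (by omega) (by omega)]
        convert (ihe (2 * c - k - 2) (by omega)).cons true using 3 <;> omega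

/-- Double-step rule. Let `n ≥ 2` and let `f` be the partial map on
`{0,1}^n` that first flips bit `0` obtaining `y'`, and, when `y'` contains a `1` whose
minimal position `i` satisfies `i + 1 ≤ n - 1`, flips bit `i + 1` of `y'`. Then:
(i) for every `k ≥ 0` with `2k + 2 ≤ 2^n - 1`, `f` is defined at `G^n_{2k}` and
`f(G^n_{2k}) = G^n_{2k+2}`; (ii) for every `k ≥ 1` with `2k + 1 ≤ 2^n - 1`, `f` is
defined at `G^n_{2k+1}` and `f(G^n_{2k+1}) = G^n_{2k-1}`. -/
theorem gray_code_double_step (n : ℕ) (hn : 2 ≤ n) :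
    (∀ k : ℕ, 2 * k + 2 ≤ 2 ^ n - 1 →
      ∃ i : ℕ, wordBit (flipBit (grayWord n (2 * k)) 0) i = true ∧
        (∀ i' < i, wordBit (flipBit (grayWord n (2 * k)) 0) i' = false) ∧
        i + 1 ≤ n - 1 ∧
        flipBit (flipBit (grayWord n (2 * k)) 0) (i + 1) = grayWord n (2 * k + 2)) ∧
    (∀ k : ℕ, 1 ≤ k → 2 * k + 1 ≤ 2 ^ n - 1 →
      ∃ i : ℕ, wordBit (flipBit (grayWord n (2 * k + 1)) 0) i = true ∧
        (∀ i' < i, wordBit (flipBit (grayWord n (2 * k + 1)) 0) i' = false) ∧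
        i + 1 ≤ n - 1 ∧
        flipBit (flipBit (grayWord n (2 * k + 1)) 0) (i + 1) = grayWord n (2 * k - 1)) := by
  refine ⟨fun k hk => ?_, fun k hk hk' => ?_⟩
  · obtain ⟨i, h1, h2, h3, h4⟩ := (doubleStep_grayWord n).1 k (by omega)
    rw [length_grayWord (by omega)] at h3
    exact ⟨i, h1, h2, by omega, h4⟩
  · obtain ⟨k, rfl⟩ := Nat.exists_eq_add_of_le' hk
    obtain ⟨i, h1, h2, h3, h4⟩ := (doubleStep_grayWord n).2 k (by omega)
    rw [length_grayWord (by omega)] at h3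
    exact ⟨i, h1, h2, by omega, h4⟩
end

section
/- Transversal successor characterization: let H = (V, E) be a hypergraph with V = {1, …, n} and let y ∈ {0,1}^n be a transversal of H. For each 1 ≤ i ≤ n with y_i = 1, let z^i = y_1⋯y_{i−1} 0 1^{n−i}. Then: (i) if some z^i is a transversal of H, then, taking the largest such i, z^i is the least transversal strictly greater than y with respect to ≺ (i.e., y ≺ z^i, and every transversal z with y ≺ z satisfies z^i = z or z^i ≺ z); (ii) if no z^i is a transversal of H, then there is no transversal z of H with y ≺ z. -/
/-- A word `y ∈ {0,1}^n` is a transversal of the hypergraph with vertex set `Fin n`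
and hyperedge set `E`, i.e., every hyperedge contains a vertex `v` with `y v = 1`. -/
def IsTransversal (n : ℕ) (E : Finset (Finset (Fin n))) (y : Fin n → Bool) : Prop :=
  ∀ e ∈ E, ∃ v ∈ e, y v = true

/-- The lexicographic order on `{0,1}^n` with the convention `1 < 0`: `x ≺ y` iff at the
first position where `x` and `y` differ, `x` has a `1` and `y` has a `0`. -/
def LexLt (n : ℕ) (x y : Fin n → Bool) : Prop :=
  ∃ i : Fin n, (∀ j : Fin n, j < i → x j = y j) ∧ x i = true ∧ y i = false

/-- The candidate successor `z^i = y_1⋯y_{i-1} 0 1^{n-i}` of a word `y` at position `i`. -/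
def succCand (n : ℕ) (y : Fin n → Bool) (i : Fin n) : Fin n → Bool :=
  fun j => if j < i then y j else if j = i then false else true

theorem IsTransversal.mono {n : ℕ} {E : Finset (Finset (Fin n))} {z w : Fin n → Bool}
    (hz : IsTransversal n E z) (h : ∀ j, z j = true → w j = true) : IsTransversal n E w :=
  fun e he => (hz e he).imp fun v hv => ⟨hv.1, h v hv.2⟩

/-- A word that dominates `z` pointwise precedes or equals `z` in the order `≺`. -/
theorem eq_or_lexLt_of_pointwise {n : ℕ} {z w : Fin n → Bool}
    (h : ∀ j, z j = true → w j = true) : w = z ∨ LexLt n w z := by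
  by_cases hwz : w = z
  · exact Or.inl hwz
  obtain ⟨i, hi, hmin⟩ := WellFounded.has_min (wellFounded_lt (α := Fin n))
    {i | w i ≠ z i} (Function.ne_iff.mp hwz)
  refine Or.inr ⟨i, fun j hj => not_not.mp fun hne => hmin j hne hj, ?_⟩
  have := h i
  have hne : w i ≠ z i := hi
  cases hw : w i <;> cases hz : z i <;> simp_all

theorem lexLt_succCand {n : ℕ} {y : Fin n → Bool} {i : Fin n} (hi : y i = true) :
    LexLt n y (succCand n y i) :=
  ⟨i, fun j hj => by simp [succCand, hj], hi, by simp [succCand]⟩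

/-- The candidate at `k` dominates every word that first differs from `y` at `k`,
having a `0` there. -/
theorem succCand_of_agree {n : ℕ} {y z : Fin n → Bool} {k : Fin n}
    (hlt : ∀ j : Fin n, j < k → y j = z j) (hk : z k = false) (j : Fin n)
    (hj : z j = true) : succCand n y k j = true := by
  have hjk : j ≠ k := by
    rintro rfl
    simp_all
  by_cases h : j < k
  · simp [succCand, h, hlt j h, hj]
  · simp [succCand, h, hjk]

/-- Transversal successor characterization. Let `y` be a transversal of a
hypergraph `H` on `n` vertices and, for each `i` with `y_i = 1`, let
`z^i = y_1⋯y_{i-1} 0 1^{n-i}`. (i) If some `z^i` is a transversal then, taking the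
largest such `i`, `z^i` is the least transversal strictly greater than `y` w.r.t. `≺`.
(ii) If no `z^i` is a transversal, then no transversal `z` satisfies `y ≺ z`. -/
theorem transversal_successor (n : ℕ) (E : Finset (Finset (Fin n)))
    (hE : ∀ e ∈ E, e.Nonempty) (y : Fin n → Bool) (hy : IsTransversal n E y) :
    (∀ i₀ : Fin n, y i₀ = true → IsTransversal n E (succCand n y i₀) →
      (∀ i : Fin n, i₀ < i → y i = true → ¬ IsTransversal n E (succCand n y i)) →
      LexLt n y (succCand n y i₀) ∧
        ∀ z : Fin n → Bool, IsTransversal n E z → LexLt n y z →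
          succCand n y i₀ = z ∨ LexLt n (succCand n y i₀) z) ∧
    ((∀ i : Fin n, y i = true → ¬ IsTransversal n E (succCand n y i)) →
      ¬ ∃ z : Fin n → Bool, IsTransversal n E z ∧ LexLt n y z) := by
  refine ⟨fun i₀ hi₀ _ hmax => ⟨lexLt_succCand hi₀, ?_⟩, ?_⟩
  · rintro z hz ⟨k, hlt, hyk, hzk⟩
    have hdom := succCand_of_agree hlt hzk
    rcases lt_trichotomy k i₀ with hk | rfl | hk
    · refine Or.inr ⟨k, fun j hj => ?_, ?_, hzk⟩
      · simp [succCand, hj.trans hk, hlt j hj]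
      · simp [succCand, hk, hyk]
    · exact eq_or_lexLt_of_pointwise hdom
    · exact absurd (hz.mono hdom) (hmax k hk hyk)
  · rintro hnone ⟨z, hz, k, hlt, hyk, hzk⟩
    exact hnone k hyk (hz.mono (succCand_of_agree hlt hzk))
end

section
/- Base assignment from a topological order: suppose ≤ is a linear order on the set of all literals over V such that l ⟶* l' in the implication graph of Γ implies l ≤ l'. Define σ : V → {0,1} by σ(v) = 1 if ¬v < v, and σ(v) = 0 otherwise (i.e., each variable receives value 0 on whichever of its two literals occurs first in the order). Then σ satisfies Γ. -/
/-- A literal over the variable set `V`: `(true, v)` is the variable `v` itself and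
`(false, v)` is its negation `¬v`. -/
abbrev Lit (V : Type) := Bool × V

/-- Negation of a literal (so that `¬¬v = v`). -/
def Lit.neg {V : Type} (l : Lit V) : Lit V := (!l.1, l.2)

/-- The value of a literal under an assignment `σ : V → {0,1}`
(with `σ(¬v) = 1 - σ(v)`). -/
def evalLit {V : Type} (σ : V → Bool) (l : Lit V) : Bool :=
  if l.1 then σ l.2 else !(σ l.2)

/-- `σ` satisfies the Krom formula `Γ` (a finite set of 2-clauses `(l ∨ l')`):
every clause contains a literal with value `1`. -/
def Satisfies {V : Type} (σ : V → Bool) (Γ : Finset (Lit V × Lit V)) : Prop :=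
  ∀ c ∈ Γ, evalLit σ c.1 = true ∨ evalLit σ c.2 = true

/-- The arc relation of the implication graph of `Γ`: each clause `(l ∨ l')` contributes
the two arcs `¬l → l'` and `¬l' → l`. -/
def Arc {V : Type} (Γ : Finset (Lit V × Lit V)) (l l' : Lit V) : Prop :=
  ∃ c ∈ Γ, (l = Lit.neg c.1 ∧ l' = c.2) ∨ (l = Lit.neg c.2 ∧ l' = c.1)

/-- Reachability `l ⟶* l'` in the implication graph of `Γ`: the reflexive-transitive
closure of the arc relation. -/
def Reach {V : Type} (Γ : Finset (Lit V × Lit V)) : Lit V → Lit V → Prop :=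
  Relation.ReflTransGen (Arc Γ)

/-- A literal of value `0` weakly precedes its negation. -/
theorem le_neg_of_evalLit_ne_true {V : Type} {le : Lit V → Lit V → Prop}
    (htotal : ∀ a b, le a b ∨ le b a) {σ : V → Bool}
    (hσ : ∀ v : V, σ v = true ↔
      (le (Lit.neg (true, v)) (true, v) ∧ ¬ le (true, v) (Lit.neg (true, v))))
    {l : Lit V} (hl : evalLit σ l ≠ true) : le l (Lit.neg l) := by
  obtain ⟨b, v⟩ := l
  have hv := hσ v
  have ht := htotal (true, v) (false, v)
  cases b <;> simp only [evalLit, Lit.neg, Bool.not_true, Bool.not_false] at * <;> grind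

/-- Base assignment from a topological order. If `≤` is a linear order on
the literals over `V` such that `l ⟶* l'` implies `l ≤ l'`, then the assignment giving
`σ(v) = 1` iff `¬v < v` (i.e., each variable gets value `0` on whichever of its literals
occurs first in the order) satisfies `Γ`. -/
theorem base_assignment_satisfies {V : Type} [Fintype V]
    (Γ : Finset (Lit V × Lit V))
    (le : Lit V → Lit V → Prop) (hlin : IsLinearOrder (Lit V) le)
    (hcompat : ∀ l l' : Lit V, Reach Γ l l' → le l l')
    (σ : V → Bool)
    (hσ : ∀ v : V, σ v = true ↔
      (le (Lit.neg (true, v)) (true, v) ∧ ¬ le (true, v) (Lit.neg (true, v)))) :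
    Satisfies σ Γ := by
  intro c hc
  by_contra! h
  have h₁ := le_neg_of_evalLit_ne_true hlin.total hσ h.1
  have h₂ := le_neg_of_evalLit_ne_true hlin.total hσ h.2
  have h₁₂ : le (Lit.neg c.1) c.2 := hcompat _ _ (.single ⟨c, hc, .inl ⟨rfl, rfl⟩⟩)
  have h₂₁ : le (Lit.neg c.2) c.1 := hcompat _ _ (.single ⟨c, hc, .inr ⟨rfl, rfl⟩⟩)
  have heq : c.1 = Lit.neg c.1 :=
    hlin.antisymm _ _ h₁ (hlin.trans _ _ _ h₁₂ (hlin.trans _ _ _ h₂ h₂₁))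
  exact Bool.not_ne_self c.1.1 (congrArg Prod.fst heq).symm
end

section
/- A Krom formula Γ over a finite variable set V is satisfiable if and only if there is no variable v ∈ V such that both v ⟶* ¬v and ¬v ⟶* v hold in the implication graph of Γ (i.e., no strongly connected component of the implication graph contains both a variable and its negation). -/
namespace Lit

variable {V : Type}

@[simp]
theorem neg_neg (l : Lit V) : l.neg.neg = l := by
  simp [neg]

theorem evalLit_neg (σ : V → Bool) (l : Lit V) : evalLit σ l.neg = !evalLit σ l := by
  rcases l with ⟨_ | _, v⟩ <;> simp [neg, evalLit]

end Lit

section ImplicationGraph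

variable {V : Type} {Γ : Finset (Lit V × Lit V)} {l l' : Lit V}

theorem Arc.neg (h : Arc Γ l l') : Arc Γ l'.neg l.neg := by
  obtain ⟨c, hc, ⟨rfl, rfl⟩ | ⟨rfl, rfl⟩⟩ := h
  · exact ⟨c, hc, Or.inr ⟨rfl, Lit.neg_neg _⟩⟩
  · exact ⟨c, hc, Or.inl ⟨rfl, Lit.neg_neg _⟩⟩

theorem Reach.neg (h : Reach Γ l l') : Reach Γ l'.neg l.neg := by
  induction h with
  | refl => exact .refl
  | tail _ hbc ih => exact .head hbc.neg ih

theorem Satisfies.evalLit_of_reach {σ : V → Bool} (hσ : Satisfies σ Γ) (h : Reach Γ l l')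
    (hl : evalLit σ l = true) : evalLit σ l' = true := by
  induction h with
  | refl => exact hl
  | tail _ hbc ih =>
    obtain ⟨c, hc, ⟨rfl, rfl⟩ | ⟨rfl, rfl⟩⟩ := hbc <;>
    · have := hσ c hc
      simp_all [Lit.evalLit_neg]

/-- A set of literals that is closed under the arcs of the implication graph of `Γ` and contains
no complementary pair of literals. -/
structure IsConsistentClosed (Γ : Finset (Lit V × Lit V)) (S : Set (Lit V)) : Prop where
  mem_of_arc : ∀ ⦃l l'⦄, Arc Γ l l' → l ∈ S → l' ∈ S
  neg_notMem : ∀ ⦃l⦄, l ∈ S → l.neg ∉ S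

namespace IsConsistentClosed

variable {S : Set (Lit V)}

theorem empty : IsConsistentClosed Γ ∅ := ⟨by simp, by simp⟩

theorem mem_of_reach (hS : IsConsistentClosed Γ S) (h : Reach Γ l l') (hl : l ∈ S) : l' ∈ S := by
  induction h with
  | refl => exact hl
  | tail _ hbc ih => exact hS.mem_of_arc hbc ih

theorem union_reach (hS : IsConsistentClosed Γ S) (hl : l.neg ∉ S) (h : ¬ Reach Γ l l.neg) :
    IsConsistentClosed Γ (S ∪ {m | Reach Γ l m}) where
  mem_of_arc := by
    rintro a b hab (ha | ha)
    · exact Or.inl (hS.mem_of_arc hab ha)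
    · exact Or.inr (Relation.ReflTransGen.tail ha hab)
  neg_notMem := by
    rintro m (hm | hm) (hm' | hm')
    · exact hS.neg_notMem hm hm'
    · exact hl (hS.mem_of_reach (by simpa using Reach.neg hm') hm)
    · exact hl (hS.mem_of_reach (Reach.neg hm) hm')
    · have h_neg : Reach Γ m l.neg := by simpa using Reach.neg hm'
      exact h (Relation.ReflTransGen.trans hm h_neg)

theorem mem_or_neg_mem_of_maximal (hS : Maximal (IsConsistentClosed Γ) S)
    (h : ¬ Reach Γ l l.neg) : l ∈ S ∨ l.neg ∈ S := by
  by_contra! hl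
  exact hl.1 (hS.2 (hS.1.union_reach hl.2 h) Set.subset_union_left (Or.inr .refl))

theorem exists_satisfies (hS : IsConsistentClosed Γ S) (hS' : ∀ l : Lit V, l ∈ S ∨ l.neg ∈ S) :
    ∃ σ : V → Bool, Satisfies σ Γ := by
  classical
  let σ : V → Bool := fun v => decide ((true, v) ∈ S)
  have eval_of_mem : ∀ l ∈ S, evalLit σ l = true := by
    rintro ⟨_ | _, v⟩ hl
    · simpa [evalLit, σ, Lit.neg] using hS.neg_notMem hl
    · simpa [evalLit, σ] using hl
  refine ⟨σ, fun c hc => ?_⟩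
  rcases hS' c.1 with h | h
  · exact Or.inl (eval_of_mem _ h)
  · exact Or.inr (eval_of_mem _ (hS.mem_of_arc ⟨c, hc, Or.inl ⟨rfl, rfl⟩⟩ h))

end IsConsistentClosed

end ImplicationGraph

/-- A Krom formula `Γ` over a finite variable set `V` is satisfiable iff
there is no variable `v` with both `v ⟶* ¬v` and `¬v ⟶* v` in the implication graph
of `Γ` (no strongly connected component contains a variable and its negation). -/
theorem krom_satisfiable_iff {V : Type} [Fintype V] (Γ : Finset (Lit V × Lit V)) :
    (∃ σ : V → Bool, Satisfies σ Γ) ↔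
      ¬ ∃ v : V, Reach Γ (true, v) (false, v) ∧ Reach Γ (false, v) (true, v) := by
  constructor
  · rintro ⟨σ, hσ⟩ ⟨v, h₁, h₂⟩
    have h_pos := hσ.evalLit_of_reach h₁
    have h_neg := hσ.evalLit_of_reach h₂
    cases hv : σ v <;> simp_all [evalLit]
  · intro h
    obtain ⟨S, -, hS⟩ := Finite.exists_le_maximal (IsConsistentClosed.empty (Γ := Γ))
    refine hS.1.exists_satisfies fun l => ?_
    by_cases hl : Reach Γ l l.neg
    · have hl' : ¬ Reach Γ l.neg l.neg.neg := by
        rw [Lit.neg_neg]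
        intro hl'
        rcases l with ⟨_ | _, v⟩
        · exact h ⟨v, hl', hl⟩
        · exact h ⟨v, hl, hl'⟩
      simpa [or_comm] using IsConsistentClosed.mem_or_neg_mem_of_maximal hS hl'
    · exact IsConsistentClosed.mem_or_neg_mem_of_maximal hS hl
end

section
/- IHS prefix-extension lemma: let V = {x_1, …, x_n} and Γ = P ∪ B, where P is a finite set of positive clauses (each a nonempty subset C ⊆ V, satisfied by σ iff σ(x) = 1 for some x ∈ C) and B is a finite set of implicative clauses (x ∨ ¬x') with x, x' ∈ V (satisfied by σ iff σ(x) = 1 or σ(x') = 0). Let G be the directed graph on V with an arc (x, x') for each clause (x ∨ ¬x') ∈ B, and for x ∈ V let tc(x) be the set of vertices reachable from x in G (under the reflexive-transitive closure). Then for every 0 ≤ i ≤ n and every p ∈ {0,1}^i: there exists an assignment σ satisfying Γ with σ(x_j) = p_j for all j ≤ i if and only if the assignment τ defined by τ(x_j) = p_j for j ≤ i and, for i < j ≤ n, τ(x_j) = 0 if x_j ∈ tc(x_k) for some k ≤ i with p_k = 0 and τ(x_j) = 1 otherwise, satisfies Γ. -/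
/-- An assignment satisfies an IHS clause set `P ∪ B`, where `P` is a set of positive
clauses (nonempty subsets of the variables, satisfied iff some member gets value `1`)
and `B` is a set of implicative clauses `(x ∨ ¬x')` (satisfied iff `σ x = 1` or
`σ x' = 0`). -/
def SatIHS (n : ℕ) (P : Finset (Finset (Fin n))) (B : Finset (Fin n × Fin n))
    (σ : Fin n → Bool) : Prop :=
  (∀ C ∈ P, ∃ v ∈ C, σ v = true) ∧ (∀ c ∈ B, σ c.1 = true ∨ σ c.2 = false)

/-- In a model of the implicative clauses, the value `false` propagates along arcs. -/
theorem SatIHS.eq_false_of_reflTransGen {n : ℕ} {P : Finset (Finset (Fin n))}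
    {B : Finset (Fin n × Fin n)} {σ : Fin n → Bool} (hσ : SatIHS n P B σ) {k j : Fin n}
    (hk : σ k = false) (hkj : Relation.ReflTransGen (fun a b => (a, b) ∈ B) k j) :
    σ j = false := by
  induction hkj with
  | refl => exact hk
  | tail _ hab ih => simpa [ih] using hσ.2 _ hab

/-- IHS prefix-extension lemma. Let `Γ = P ∪ B` over variables
`x_1, …, x_n`, let `G` be the directed graph with an arc `(x, x')` for each clause
`(x ∨ ¬x') ∈ B`, and let `tc(x)` be the set of vertices reachable from `x`. For every
`0 ≤ i ≤ n` and `p ∈ {0,1}^i`: there is an assignment `σ` satisfying `Γ` with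
`σ(x_j) = p_j` for all `j ≤ i` iff the assignment `τ`, defined by `τ(x_j) = p_j` for
`j ≤ i` and, for `i < j ≤ n`, `τ(x_j) = 0` iff `x_j ∈ tc(x_k)` for some `k ≤ i` with
`p_k = 0`, satisfies `Γ`. -/
theorem ihs_prefix_extension (n : ℕ)
    (P : Finset (Finset (Fin n))) (hP : ∀ C ∈ P, C.Nonempty)
    (B : Finset (Fin n × Fin n))
    (i : ℕ) (hi : i ≤ n) (p : Fin n → Bool)
    (τ : Fin n → Bool)
    (hτ₁ : ∀ j : Fin n, (j : ℕ) < i → τ j = p j)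
    (hτ₂ : ∀ j : Fin n, i ≤ (j : ℕ) →
      (τ j = false ↔ ∃ k : Fin n, (k : ℕ) < i ∧ p k = false ∧
        Relation.ReflTransGen (fun a b => (a, b) ∈ B) k j)) :
    (∃ σ : Fin n → Bool, SatIHS n P B σ ∧ ∀ j : Fin n, (j : ℕ) < i → σ j = p j) ↔
      SatIHS n P B τ := by
  refine ⟨?_, fun h => ⟨τ, h, hτ₁⟩⟩
  rintro ⟨σ, hσ, hσp⟩
  have reach_of_false : ∀ j, τ j = false → ∃ k : Fin n, (k : ℕ) < i ∧ p k = false ∧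
      Relation.ReflTransGen (fun a b => (a, b) ∈ B) k j := by
    intro j hj
    rcases lt_or_ge (j : ℕ) i with hji | hji
    · exact ⟨j, hji, (hτ₁ j hji).symm.trans hj, .refl⟩
    · exact (hτ₂ j hji).1 hj
  have false_of_reach : ∀ k j : Fin n, (k : ℕ) < i → p k = false →
      Relation.ReflTransGen (fun a b => (a, b) ∈ B) k j → σ j = false :=
    fun k j hki hpk hkj => hσ.eq_false_of_reflTransGen ((hσp k hki).trans hpk) hkj
  constructor
  · intro C hC
    obtain ⟨v, hvC, hv⟩ := hσ.1 C hC
    refine ⟨v, hvC, ?_⟩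
    by_contra hτv
    obtain ⟨k, hki, hpk, hkv⟩ := reach_of_false v (by simpa using hτv)
    simp [false_of_reach k v hki hpk hkv] at hv
  · intro c hc
    rw [or_iff_not_imp_left]
    intro hτc
    obtain ⟨k, hki, hpk, hkc⟩ := reach_of_false c.1 (by simpa using hτc)
    have hkc' := hkc.tail (c := c.2) hc
    rcases lt_or_ge (c.2 : ℕ) i with hci | hci
    · rw [hτ₁ _ hci, ← hσp _ hci]
      exact false_of_reach k c.2 hki hpk hkc'
    · exact (hτ₂ _ hci).2 ⟨k, hki, hpk, hkc'⟩
end
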